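/- Let X be an n×p real matrix and s₀ an integer with 1 ≤ 2s₀ ≤ p. Suppose X satisfies RE(s₀,1,X) with constant K(s₀,1) > 0. Then every nonzero v ∈ ℝ^p with at most 2s₀ nonzero coordinates satisfies ‖Xv‖₂²/(n·‖v‖₂²) ≥ 1/(2·K(s₀,1)²); in other words, Λ_min(2s₀) ≥ 1/(2·K(s₀,1)²). -/

import Mathlib

open Finset Matrix Real
open scoped BigOperators Classical

noncomputable section

namespace ThreshLasso

/-- ℓ₂ norm of a finite real vector. -/
def l2 {m : ℕ} (v : Fin m → ℝ) : ℝ := Real.sqrt (∑ i, (v i) ^ 2)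

/-- ℓ₁ norm of a finite real vector. -/
def l1 {m : ℕ} (v : Fin m → ℝ) : ℝ := ∑ i, |v i|

/-- Restriction of a vector to a set of coordinates (zero outside). -/
def restr {p : ℕ} (v : Fin p → ℝ) (T : Finset (Fin p)) : Fin p → ℝ :=
  fun j => if j ∈ T then v j else 0

/-- Support of a vector, as a `Finset`. -/
def supp {p : ℕ} (v : Fin p → ℝ) : Finset (Fin p) :=
  Finset.univ.filter fun j => v j ≠ 0

/-- `L` is the minimal `m`-sparse eigenvalue `Λ_min(m)` of `X`:
the least value of `‖Xv‖₂²/(n‖v‖₂²)` over nonzero `v` with at most `m`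
nonzero coordinates. -/
def IsLambdaMin {n p : ℕ} (X : Matrix (Fin n) (Fin p) ℝ) (m : ℕ) (L : ℝ) : Prop :=
  IsLeast {r : ℝ | ∃ v : Fin p → ℝ, v ≠ 0 ∧ (supp v).card ≤ m ∧
    r = (l2 (X.mulVec v)) ^ 2 / (n * (l2 v) ^ 2)} L

/-- `L` is the maximal `m`-sparse eigenvalue `Λ_max(m)` of `X`
(with the convention `Λ_max(0) = 0`, implemented by inserting `0` in the set,
which does not change the maximum when `m ≥ 1`). -/
def IsLambdaMax {n p : ℕ} (X : Matrix (Fin n) (Fin p) ℝ) (m : ℕ) (L : ℝ) : Prop :=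
  IsGreatest (insert (0 : ℝ) {r : ℝ | ∃ v : Fin p → ℝ, v ≠ 0 ∧ (supp v).card ≤ m ∧
    r = (l2 (X.mulVec v)) ^ 2 / (n * (l2 v) ^ 2)}) L

/-- `θ` is the restricted orthogonality constant `θ_{m,m'}` of `X`: the smallest
nonnegative `t` such that `|⟨Xu, Xu'⟩|/n ≤ t‖u‖₂‖u'‖₂` for all `u, u'` supported
on disjoint sets of cardinality at most `m`, `m'` respectively. -/
def IsTheta {n p : ℕ} (X : Matrix (Fin n) (Fin p) ℝ) (m m' : ℕ) (θ : ℝ) : Prop :=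
  IsLeast {t : ℝ | 0 ≤ t ∧ ∀ (u u' : Fin p → ℝ) (T T' : Finset (Fin p)),
    Disjoint T T' → T.card ≤ m → T'.card ≤ m' →
    (∀ j, j ∉ T → u j = 0) → (∀ j, j ∉ T' → u' j = 0) →
    |∑ i, (X.mulVec u i) * (X.mulVec u' i)| / n ≤ t * (l2 u * l2 u')} θ

/-- Restricted eigenvalue condition `RE(s₀, k₀, X)` with constant `K`. -/
def RECond {n p : ℕ} (X : Matrix (Fin n) (Fin p) ℝ) (s₀ : ℕ) (k₀ K : ℝ) : Prop :=
  0 < K ∧ ∀ (v : Fin p → ℝ) (J : Finset (Fin p)), J.card ≤ s₀ →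
    l1 (restr v Jᶜ) ≤ k₀ * l1 (restr v J) →
    l2 (restr v J) / K ≤ l2 (X.mulVec v) / Real.sqrt n

/-- `s₀` is the essential sparsity of `β`: the smallest nonnegative integer `m`
with `∑ᵢ min(βᵢ², λ²σ²) ≤ m λ²σ²`. -/
def EssSparsity {p : ℕ} (β : Fin p → ℝ) (lam σ : ℝ) (s₀ : ℕ) : Prop :=
  IsLeast {m : ℕ | ∑ i, min ((β i) ^ 2) (lam ^ 2 * σ ^ 2) ≤ (m : ℝ) * (lam ^ 2 * σ ^ 2)} s₀

/-- `T₀` is a set of indices of the `s₀` largest coordinates of `β` in absolute value. -/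
def TopSet {p : ℕ} (β : Fin p → ℝ) (s₀ : ℕ) (T₀ : Finset (Fin p)) : Prop :=
  T₀.card = s₀ ∧ ∀ i ∈ T₀, ∀ j, j ∉ T₀ → |β j| ≤ |β i|

/-- `T₁` is a set of indices of the `s₀` largest coordinates of `h` in absolute
value outside `T₀`. -/
def TopSetOutside {p : ℕ} (h : Fin p → ℝ) (s₀ : ℕ) (T₀ T₁ : Finset (Fin p)) : Prop :=
  T₁.card = s₀ ∧ Disjoint T₀ T₁ ∧
    ∀ i ∈ T₁, ∀ j, j ∉ T₀ → j ∉ T₁ → |h j| ≤ |h i|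

/-- `b` is a Lasso minimizer with penalty `lamn` for data `(X, Y)`. -/
def IsLassoSol {n p : ℕ} (X : Matrix (Fin n) (Fin p) ℝ) (Y : Fin n → ℝ)
    (lamn : ℝ) (b : Fin p → ℝ) : Prop :=
  ∀ b' : Fin p → ℝ,
    1 / (2 * n) * (l2 (Y - X.mulVec b)) ^ 2 + lamn * l1 b ≤
    1 / (2 * n) * (l2 (Y - X.mulVec b')) ^ 2 + lamn * l1 b'

/-- Submatrix of the columns of `X` indexed by `I`. -/
def colSub {n p : ℕ} (X : Matrix (Fin n) (Fin p) ℝ) (I : Finset (Fin p)) :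
    Matrix (Fin n) {j // j ∈ I} ℝ :=
  Matrix.of fun i j => X i j.1

/-- The Gram matrix `X_Iᵀ X_I` is invertible. -/
def GramInvertible {n p : ℕ} (X : Matrix (Fin n) (Fin p) ℝ) (I : Finset (Fin p)) : Prop :=
  IsUnit ((colSub X I)ᵀ * colSub X I).det

/-- The OLS refit of `Y` on the columns of `X` indexed by `I`:
`(X_Iᵀ X_I)⁻¹ X_Iᵀ Y` on `I`, and `0` off `I`. -/
def olsRefit {n p : ℕ} (X : Matrix (Fin n) (Fin p) ℝ) (Y : Fin n → ℝ)
    (I : Finset (Fin p)) : Fin p → ℝ :=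
  fun j => if h : j ∈ I then
    (((colSub X I)ᵀ * colSub X I)⁻¹).mulVec ((colSub X I)ᵀ.mulVec Y) ⟨j, h⟩
  else 0


lemma l2_sq {m : ℕ} (v : Fin m → ℝ) : l2 v ^ 2 = ∑ i, v i ^ 2 :=
  Real.sq_sqrt (Finset.sum_nonneg fun _ _ => sq_nonneg _)

lemma l1_restr {p : ℕ} (v : Fin p → ℝ) (T : Finset (Fin p)) :
    l1 (restr v T) = ∑ i ∈ T, |v i| := by
  simp [l1, restr, apply_ite abs, Finset.sum_ite_mem]

lemma l2_restr_sq {p : ℕ} (v : Fin p → ℝ) (T : Finset (Fin p)) :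
    l2 (restr v T) ^ 2 = ∑ i ∈ T, v i ^ 2 := by
  simp [l2_sq, restr, ite_pow, Finset.sum_ite_mem]

/-- A finite set contains a subset of any admissible size on which `f` is largest. -/
lemma exists_subset_card_eq_forall_le {α : Type*} [DecidableEq α] (S : Finset α) (f : α → ℝ) (k : ℕ)
    (hk : k ≤ S.card) :
    ∃ J ⊆ S, J.card = k ∧ ∀ i ∈ J, ∀ j ∈ S \ J, f j ≤ f i := by
  induction k with
  | zero => exact ⟨∅, by simp, by simp, by simp⟩
  | succ k ih =>
    obtain ⟨J, hJS, hJ, htop⟩ := ih (by omega)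
    have hne : (S \ J).Nonempty := by
      rw [← Finset.card_pos, Finset.card_sdiff_of_subset hJS]
      omega
    obtain ⟨a, ha, hmax⟩ := Finset.exists_max_image (S \ J) f hne
    obtain ⟨haS, haJ⟩ := Finset.mem_sdiff.mp ha
    refine ⟨insert a J, Finset.insert_subset haS hJS, ?_, ?_⟩
    · rw [Finset.card_insert_of_notMem haJ, hJ]
    · intro i hi j hj
      have hj' : j ∈ S \ J :=
        Finset.sdiff_subset_sdiff le_rfl (Finset.subset_insert a J) hj
      rcases Finset.mem_insert.mp hi with rfl | hi
      · exact hmax j hj'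
      · exact htop i hi j hj'

/-- If `f` on `A` is dominated by `f` on `B`, and `A` and `B` have the same size, then so
are the sums. -/
lemma sum_le_sum_of_card_eq {α : Type*} {A B : Finset α} (f : α → ℝ)
    (hcard : A.card = B.card) (h : ∀ i ∈ B, ∀ j ∈ A, f j ≤ f i) :
    ∑ j ∈ A, f j ≤ ∑ i ∈ B, f i := by
  rcases B.eq_empty_or_nonempty with rfl | hB
  · simp [Finset.card_eq_zero.mp (hcard.trans Finset.card_empty)]
  · obtain ⟨b, hb, hmin⟩ := Finset.exists_min_image B f hB
    calc ∑ j ∈ A, f j ≤ A.card • f b := Finset.sum_le_card_nsmul _ _ _ (h b hb)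
      _ = B.card • f b := by rw [hcard]
      _ ≤ ∑ i ∈ B, f i := Finset.card_nsmul_le_sum _ _ _ hmin

/-- A `2s`-sparse vector has `s` coordinates carrying at least half of its `ℓ₁` norm and of
its squared `ℓ₂` norm. -/
lemma exists_dominant_half {p s : ℕ} (h2s : 2 * s ≤ p) (v : Fin p → ℝ)
    (hv : (supp v).card ≤ 2 * s) :
    ∃ J : Finset (Fin p), J.card = s ∧ l1 (restr v Jᶜ) ≤ l1 (restr v J) ∧
      l2 v ^ 2 ≤ 2 * l2 (restr v J) ^ 2 := by
  obtain ⟨S, hS, hScard⟩ :=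
    Finset.exists_superset_card_eq hv (by simpa using h2s)
  obtain ⟨J, hJS, hJ, htop⟩ :=
    exists_subset_card_eq_forall_le S (fun i => |v i|) s (by omega)
  have hcard : (S \ J).card = J.card := by
    rw [Finset.card_sdiff_of_subset hJS]
    omega
  have hzero : ∀ i, i ∉ S → v i = 0 := fun i hi => by
    by_contra h
    exact hi (hS (by simp [supp, h]))
  have hcompl : ∀ g : ℝ → ℝ, g 0 = 0 → ∑ i ∈ Jᶜ, g (v i) = ∑ i ∈ S \ J, g (v i) := by
    intro g hg
    refine (Finset.sum_subset (fun i hi => ?_) (fun i hi hi' => ?_)).symm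
    · exact Finset.mem_compl.mpr (Finset.mem_sdiff.mp hi).2
    · rw [hzero i fun h => hi' (Finset.mem_sdiff.mpr ⟨h, Finset.mem_compl.mp hi⟩), hg]
  refine ⟨J, hJ, ?_, ?_⟩
  · rw [l1_restr, l1_restr, hcompl (fun x => |x|) abs_zero]
    exact sum_le_sum_of_card_eq (fun i => |v i|) hcard htop
  · have hsq : ∑ i ∈ S \ J, v i ^ 2 ≤ ∑ i ∈ J, v i ^ 2 :=
      sum_le_sum_of_card_eq (fun i => v i ^ 2) hcard
        fun i hi j hj => sq_le_sq.mpr (htop i hi j hj)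
    rw [l2_restr_sq, l2_sq, ← Finset.sum_add_sum_compl J,
      hcompl (fun x => x ^ 2) (by norm_num)]
    linarith

/-- RE(s₀,1,X) implies a lower sparse eigenvalue bound at level 2s₀. -/
theorem statement_5
    (n p s₀ : ℕ) (hn : 0 < n) (hs₀ : 1 ≤ s₀) (h2s₀ : 2 * s₀ ≤ p)
    (X : Matrix (Fin n) (Fin p) ℝ) (K : ℝ) (hRE : RECond X s₀ 1 K) :
    (∀ v : Fin p → ℝ, v ≠ 0 → (supp v).card ≤ 2 * s₀ →
      1 / (2 * K ^ 2) ≤ (l2 (X.mulVec v)) ^ 2 / (n * (l2 v) ^ 2)) ∧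
    ∀ L : ℝ, IsLambdaMin X (2 * s₀) L → 1 / (2 * K ^ 2) ≤ L := by
  obtain ⟨hK, hRE⟩ := hRE
  have hsparse : ∀ v : Fin p → ℝ, v ≠ 0 → (supp v).card ≤ 2 * s₀ →
      1 / (2 * K ^ 2) ≤ (l2 (X.mulVec v)) ^ 2 / (n * (l2 v) ^ 2) := by
    intro v hv hcard
    obtain ⟨J, hJ, hl1, hl2⟩ := exists_dominant_half h2s₀ v hcard
    have hre := hRE v J hJ.le (by rwa [one_mul])
    have hn' : (0 : ℝ) < n := Nat.cast_pos.mpr hn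
    have hpos : 0 < l2 v ^ 2 := by
      obtain ⟨i, hi⟩ := Function.ne_iff.mp hv
      rw [l2_sq]
      exact Finset.sum_pos' (fun _ _ => sq_nonneg _)
        ⟨i, Finset.mem_univ i, sq_pos_of_ne_zero hi⟩
    have hnonneg : 0 ≤ l2 (restr v J) := Real.sqrt_nonneg _
    have hre_sq := pow_le_pow_left₀ (div_nonneg hnonneg hK.le) hre 2
    rw [div_pow, div_pow, Real.sq_sqrt hn'.le, div_le_div_iff₀ (by positivity) hn'] at hre_sq
    rw [div_le_div_iff₀ (by positivity) (by positivity)]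
    nlinarith [mul_le_mul_of_nonneg_left hl2 hn'.le]
  refine ⟨hsparse, fun L hL => ?_⟩
  obtain ⟨v, hv, hcard, rfl⟩ := hL.1
  exact hsparse v hv hcard

end ThreshLasso
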